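/- arXiv:2602.23291 — 2 statements merged into one kernel-verified Lean document; each statement's English description precedes it below -/
import Mathlib

section
/- Let n ≥ 2 and let W be a connected proximity matrix with D its diagonal matrix of (positive) column sums and D^{-1/2} W D^{-1/2} = Γ Λ Γᵀ a spectral decomposition. Suppose D = d·I for some d > 0 and Λ has at least three distinct diagonal entries. Let τ_U, τ_ε > 0 and φ_U ≠ 0 with I − φ_U Λ positive definite, and let τ̃_U, τ̃_ε > 0 and φ̃_U with I − φ̃_U Λ positive definite. If τ_U^{-1} (I − φ_U Λ)^{-1} + τ_ε^{-1} Γᵀ D Γ = τ̃_U^{-1} (I − φ̃_U Λ)^{-1} + τ̃_ε^{-1} Γᵀ D Γ, then τ̃_U = τ_U, φ̃_U = φ_U, and τ̃_ε = τ_ε. -/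
open Matrix

/-- A real quadratic with three distinct roots has vanishing coefficients. -/
theorem quadratic_coeffs_eq_zero {p q r x y z : ℝ} (hxy : x ≠ y) (hxz : x ≠ z) (hyz : y ≠ z)
    (hx : p * x ^ 2 + q * x + r = 0) (hy : p * y ^ 2 + q * y + r = 0)
    (hz : p * z ^ 2 + q * z + r = 0) : p = 0 ∧ q = 0 ∧ r = 0 := by
  have h₁ : p * (x + y) + q = 0 :=
    mul_left_cancel₀ (sub_ne_zero.2 hxy) (by linear_combination hx - hy)
  have h₂ : p * (x + z) + q = 0 :=
    mul_left_cancel₀ (sub_ne_zero.2 hxz) (by linear_combination hx - hz)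
  have hp : p = 0 :=
    mul_left_cancel₀ (sub_ne_zero.2 hyz) (by linear_combination h₁ - h₂)
  subst hp
  have hq : q = 0 := by linarith
  subst hq
  exact ⟨rfl, rfl, by linarith⟩

theorem one_sub_smul_diagonal {n : ℕ} (φ : ℝ) (lam : Fin n → ℝ) :
    1 - φ • Matrix.diagonal lam = Matrix.diagonal fun i => 1 - φ * lam i := by
  ext i j
  by_cases h : i = j
  · subst h; simp
  · simp [h]

theorem one_sub_mul_pos_of_posDef {n : ℕ} {φ : ℝ} {lam : Fin n → ℝ}
    (h : (1 - φ • Matrix.diagonal lam).PosDef) (i : Fin n) : 0 < 1 - φ * lam i := by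
  rw [one_sub_smul_diagonal] at h
  exact Matrix.posDef_diagonal_iff.1 h i

theorem inv_one_sub_smul_diagonal_apply_self {n : ℕ} {φ : ℝ} {lam : Fin n → ℝ}
    (h : ∀ i, 0 < 1 - φ * lam i) (i : Fin n) :
    (1 - φ • Matrix.diagonal lam)⁻¹ i i = (1 - φ * lam i)⁻¹ := by
  have hinv : (1 - φ • Matrix.diagonal lam)⁻¹ =
      Matrix.diagonal fun i => (1 - φ * lam i)⁻¹ := by
    apply Matrix.inv_eq_right_inv
    rw [one_sub_smul_diagonal, Matrix.diagonal_mul_diagonal, ← Matrix.diagonal_one]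
    congr 1
    funext j
    exact mul_inv_cancel₀ (h j).ne'
  rw [hinv, Matrix.diagonal_apply_eq]

/-- Lemma A1(ii): identification of `(τ_U, φ_U, τ_ε)` from the conditional variance
of `Y` given `Z` in the CAR model, when the connected proximity matrix has a
scalar degree matrix `D = d·I` and `Λ` has at least three distinct diagonal
entries. -/
theorem car_condvar_identification_scaled_identity {n : ℕ} (hn : 2 ≤ n)
    (W : Matrix (Fin n) (Fin n) ℝ)
    (hWsymm : W.IsSymm)
    (hWnonneg : ∀ i j, 0 ≤ W i j)
    (hWdiag : ∀ i, W i i = 0)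
    (hWconn : ∀ i j : Fin n, i ≠ j → ∃ (m : ℕ) (l : Fin (m + 1) → Fin n),
      l 0 = i ∧ l (Fin.last m) = j ∧ ∀ r : Fin m, 0 < W (l r.castSucc) (l r.succ))
    (d : Fin n → ℝ) (hd : ∀ i, d i = ∑ j, W j i) (hdpos : ∀ i, 0 < d i)
    (dconst : ℝ) (hdconst : 0 < dconst) (hDscalar : ∀ i, d i = dconst)
    (Γ Λ : Matrix (Fin n) (Fin n) ℝ)
    (hΓ : Γ * Γᵀ = 1) (hΓ' : Γᵀ * Γ = 1)
    (lam : Fin n → ℝ) (hΛdiag : Λ = Matrix.diagonal lam)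
    (hΛ3 : ∃ i j k : Fin n, lam i ≠ lam j ∧ lam i ≠ lam k ∧ lam j ≠ lam k)
    (hspec : (Matrix.diagonal fun i => (Real.sqrt (d i))⁻¹) * W *
        (Matrix.diagonal fun i => (Real.sqrt (d i))⁻¹) = Γ * Λ * Γᵀ)
    (τU φU τε τU' φU' τε' : ℝ)
    (hτU : 0 < τU) (hτε : 0 < τε) (hφU : φU ≠ 0)
    (hτU' : 0 < τU') (hτε' : 0 < τε')
    (hpd : (1 - φU • Λ).PosDef) (hpd' : (1 - φU' • Λ).PosDef)
    (heq : τU⁻¹ • (1 - φU • Λ)⁻¹ + τε⁻¹ • (Γᵀ * Matrix.diagonal d * Γ)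
      = τU'⁻¹ • (1 - φU' • Λ)⁻¹ + τε'⁻¹ • (Γᵀ * Matrix.diagonal d * Γ)) :
    τU' = τU ∧ φU' = φU ∧ τε' = τε := by
  subst hΛdiag
  have hpos := one_sub_mul_pos_of_posDef hpd
  have hpos' := one_sub_mul_pos_of_posDef hpd'
  have hD : Γᵀ * Matrix.diagonal d * Γ = dconst • (1 : Matrix (Fin n) (Fin n) ℝ) := by
    rw [funext hDscalar, ← Matrix.smul_one_eq_diagonal, Matrix.mul_smul, Matrix.mul_one,
      Matrix.smul_mul, hΓ']
  rw [hD] at heq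
  set c := (τε⁻¹ - τε'⁻¹) * dconst with hc
  have key : ∀ i, (c * φU * φU') * lam i ^ 2
      + (τU'⁻¹ * φU - τU⁻¹ * φU' - c * (φU + φU')) * lam i + (τU⁻¹ + c - τU'⁻¹) = 0 := by
    intro i
    have h := congrFun (congrFun heq i) i
    simp only [Matrix.add_apply, Matrix.smul_apply, smul_eq_mul, Matrix.one_apply_eq, mul_one,
      inv_one_sub_smul_diagonal_apply_self hpos, inv_one_sub_smul_diagonal_apply_self hpos'] at h
    have e := mul_inv_cancel₀ (hpos i).ne'
    have e' := mul_inv_cancel₀ (hpos' i).ne'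
    rw [hc]
    linear_combination (1 - φU * lam i) * (1 - φU' * lam i) * h
      - τU⁻¹ * (1 - φU' * lam i) * e + τU'⁻¹ * (1 - φU * lam i) * e'
  obtain ⟨i, j, k, hij, hik, hjk⟩ := hΛ3
  obtain ⟨h₂, h₁, h₀⟩ := quadratic_coeffs_eq_zero hij hik hjk (key i) (key j) (key k)
  have ha : 0 < τU⁻¹ := inv_pos.2 hτU
  have hc0 : c = 0 := by
    rcases mul_eq_zero.1 h₂ with h | h
    · exact (mul_eq_zero.1 h).resolve_right hφU
    · exfalso
      have : τU⁻¹ * φU = 0 := by rw [h] at h₁; linear_combination h₁ + φU * h₀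
      exact mul_ne_zero ha.ne' hφU this
  rw [hc0] at h₀ h₁
  have hτ : τU'⁻¹ = τU⁻¹ := by linarith
  refine ⟨inv_injective hτ, ?_, ?_⟩
  · rw [hτ] at h₁
    exact mul_left_cancel₀ ha.ne' (by linear_combination -h₁)
  · have h := (mul_eq_zero.1 (hc.symm.trans hc0)).resolve_right hdconst.ne'
    exact inv_injective (by linarith)
end

section
/- Let a_1, a_2, a_3 be real numbers and let λ_1, λ_2, λ_3 ∈ [0,1) be mutually distinct. If the equation a_1/√(1−λ_1+λ_1 ω) + a_2/√(1−λ_2+λ_2 ω) + a_3/√(1−λ_3+λ_3 ω) = 0 holds for ω = 0 and for at least two distinct positive values of ω, then a_1 = a_2 = a_3 = 0. -/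
/-- The convex combination `1 - l + l * x` is positive for `l ∈ [0, 1)` and `x ≥ 0`. -/
lemma one_sub_add_mul_pos {l x : ℝ} (hl : l ∈ Set.Ico (0 : ℝ) 1) (hx : 0 ≤ x) :
    0 < 1 - l + l * x := by
  have := mul_nonneg hl.1 hx
  linarith [hl.2]

lemma hasDerivAt_sqrt_div_sqrt {k l x : ℝ} (hk : k ∈ Set.Ico (0 : ℝ) 1)
    (hl : l ∈ Set.Ico (0 : ℝ) 1) (hx : 0 ≤ x) :
    HasDerivAt (fun y => √(1 - k + k * y) / √(1 - l + l * y))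
      ((k - l) / (2 * √(1 - k + k * x) * √(1 - l + l * x) ^ 3)) x := by
  have hK := one_sub_add_mul_pos hk hx
  have hL := one_sub_add_mul_pos hl hx
  have affine (m : ℝ) : HasDerivAt (fun y => 1 - m + m * y) m x := by
    simpa using ((hasDerivAt_id x).const_mul m).const_add (1 - m)
  have hsK := Real.sqrt_pos.2 hK
  have hsL := Real.sqrt_pos.2 hL
  refine (((affine k).sqrt hK.ne').div ((affine l).sqrt hL.ne') hsL.ne').congr_deriv ?_
  have eK := Real.sq_sqrt hK.le
  have eL := Real.sq_sqrt hL.le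
  generalize √(1 - k + k * x) = p at *
  generalize √(1 - l + l * x) = q at *
  field_simp
  rw [eK, eL]
  ring

/-- A combination of two inverse cubed square roots vanishing at two points is trivial. -/
lemma eq_zero_of_div_sqrt_pow_three_add_eq_zero {k l b c x y : ℝ}
    (hk : k ∈ Set.Ico (0 : ℝ) 1) (hl : l ∈ Set.Ico (0 : ℝ) 1) (hkl : k ≠ l)
    (hx : 0 ≤ x) (hy : 0 ≤ y) (hxy : x ≠ y)
    (ex : b / √(1 - k + k * x) ^ 3 + c / √(1 - l + l * x) ^ 3 = 0)
    (ey : b / √(1 - k + k * y) ^ 3 + c / √(1 - l + l * y) ^ 3 = 0) :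
    b = 0 ∧ c = 0 := by
  have hKx := one_sub_add_mul_pos hk hx
  have hLx := one_sub_add_mul_pos hl hx
  have hKy := one_sub_add_mul_pos hk hy
  have hLy := one_sub_add_mul_pos hl hy
  have sKx := Real.sqrt_pos.2 hKx
  have sLx := Real.sqrt_pos.2 hLx
  have sKy := Real.sqrt_pos.2 hKy
  have sLy := Real.sqrt_pos.2 hLy
  have hb : b = 0 := by
    by_contra hb
    rw [div_add_div _ _ (by positivity) (by positivity), div_eq_zero_iff,
      or_iff_left (by positivity)] at ex ey
    have hcube : (√(1 - l + l * x) * √(1 - k + k * y)) ^ 3 =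
        (√(1 - l + l * y) * √(1 - k + k * x)) ^ 3 := by
      apply mul_left_cancel₀ hb
      linear_combination √(1 - k + k * y) ^ 3 * ex - √(1 - k + k * x) ^ 3 * ey
    have hbase := (pow_left_inj₀ (by positivity) (by positivity) three_ne_zero).1 hcube
    rw [← Real.sqrt_mul hLx.le, ← Real.sqrt_mul hLy.le,
      Real.sqrt_inj (by positivity) (by positivity)] at hbase
    exact mul_ne_zero (sub_ne_zero.2 hkl) (sub_ne_zero.2 hxy) (by linear_combination -hbase)
  refine ⟨hb, ?_⟩
  simpa [hb, sLx.ne'] using ex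

/-- The functions `x ↦ 1 / √(1 - l + l * x)` for three distinct `l ∈ [0, 1)` form a Chebyshev
system on `[0, ∞)`. -/
lemma eq_zero_of_div_sqrt_add_add_eq_zero {a b c k l m x y z : ℝ}
    (hk : k ∈ Set.Ico (0 : ℝ) 1) (hl : l ∈ Set.Ico (0 : ℝ) 1) (hm : m ∈ Set.Ico (0 : ℝ) 1)
    (hkl : k ≠ l) (hkm : k ≠ m) (hlm : l ≠ m) (hx : 0 ≤ x) (hxy : x < y) (hyz : y < z)
    (h : ∀ w ∈ ({x, y, z} : Set ℝ),
      a / √(1 - k + k * w) + b / √(1 - l + l * w) + c / √(1 - m + m * w) = 0) :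
    a = 0 ∧ b = 0 ∧ c = 0 := by
  let g : ℝ → ℝ := fun w => b * (√(1 - k + k * w) / √(1 - l + l * w)) +
    c * (√(1 - k + k * w) / √(1 - m + m * w))
  have hg : ∀ w ∈ ({x, y, z} : Set ℝ), 0 ≤ w → g w = -a := by
    intro w hw hw0
    have hs := Real.sqrt_pos.2 (one_sub_add_mul_pos hk hw0)
    have ha : √(1 - k + k * w) * (a / √(1 - k + k * w)) = a := mul_div_cancel₀ a hs.ne'
    dsimp only [g]
    linear_combination √(1 - k + k * w) * h w hw - ha
  have hgd (w : ℝ) (hw : 0 ≤ w) := ((hasDerivAt_sqrt_div_sqrt hk hl hw).const_mul b).add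
    ((hasDerivAt_sqrt_div_sqrt hk hm hw).const_mul c)
  have rolle (s t : ℝ) (hs : 0 ≤ s) (hst : s < t) (e : g s = g t) :
      ∃ w ∈ Set.Ioo s t, b * (k - l) / √(1 - l + l * w) ^ 3 +
        c * (k - m) / √(1 - m + m * w) ^ 3 = 0 := by
    obtain ⟨w, hw, hw'⟩ := exists_hasDerivAt_eq_zero hst
      (fun w hw => (hgd w (hs.trans hw.1)).continuousAt.continuousWithinAt) e
      (fun w hw => hgd w (hs.trans hw.1.le))
    refine ⟨w, hw, ?_⟩
    have hw0 : 0 ≤ w := hs.trans hw.1.le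
    have sk := Real.sqrt_pos.2 (one_sub_add_mul_pos hk hw0)
    have sl := Real.sqrt_pos.2 (one_sub_add_mul_pos hl hw0)
    have sm := Real.sqrt_pos.2 (one_sub_add_mul_pos hm hw0)
    field_simp at hw' ⊢
    linear_combination hw'
  have hy : 0 ≤ y := hx.trans hxy.le
  have hz : 0 ≤ z := hy.trans hyz.le
  have gx := hg x (by simp) hx
  have gy := hg y (by simp) hy
  have gz := hg z (by simp) hz
  obtain ⟨u, hu, eu⟩ := rolle x y hx hxy (gx.trans gy.symm)
  obtain ⟨v, hv, ev⟩ := rolle y z hy hyz (gy.trans gz.symm)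
  obtain ⟨hb, hc⟩ := eq_zero_of_div_sqrt_pow_three_add_eq_zero hl hm hlm
    (hx.trans hu.1.le) (hy.trans hv.1.le) (hu.2.trans hv.1).ne eu ev
  replace hb := (mul_eq_zero.1 hb).resolve_right (sub_ne_zero.2 hkl)
  replace hc := (mul_eq_zero.1 hc).resolve_right (sub_ne_zero.2 hkm)
  refine ⟨?_, hb, hc⟩
  simpa [g, hb, hc] using gx

/-- Lemma A9 (`lem:lcar-pars-linind`): for mutually distinct
`λ_1, λ_2, λ_3 ∈ [0,1)`, if
`a_1/√(1−λ_1+λ_1ω) + a_2/√(1−λ_2+λ_2ω) + a_3/√(1−λ_3+λ_3ω) = 0` holds at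
`ω = 0` and at two distinct positive values of `ω`, then `a_1 = a_2 = a_3 = 0`. -/
theorem lcar_pars_linear_independence
    (a1 a2 a3 : ℝ) (lam1 lam2 lam3 : ℝ)
    (h1 : lam1 ∈ Set.Ico (0 : ℝ) 1) (h2 : lam2 ∈ Set.Ico (0 : ℝ) 1)
    (h3 : lam3 ∈ Set.Ico (0 : ℝ) 1)
    (h12 : lam1 ≠ lam2) (h13 : lam1 ≠ lam3) (h23 : lam2 ≠ lam3)
    (w1 w2 : ℝ) (hw1 : 0 < w1) (hw2 : 0 < w2) (hw : w1 ≠ w2)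
    (heq : ∀ ω ∈ ({0, w1, w2} : Set ℝ),
      a1 / Real.sqrt (1 - lam1 + lam1 * ω) + a2 / Real.sqrt (1 - lam2 + lam2 * ω)
        + a3 / Real.sqrt (1 - lam3 + lam3 * ω) = 0) :
    a1 = 0 ∧ a2 = 0 ∧ a3 = 0 := by
  rcases hw.lt_or_gt with hlt | hlt
  · exact eq_zero_of_div_sqrt_add_add_eq_zero h1 h2 h3 h12 h13 h23 le_rfl hw1 hlt heq
  · rw [Set.pair_comm] at heq
    exact eq_zero_of_div_sqrt_add_add_eq_zero h1 h2 h3 h12 h13 h23 le_rfl hw2 hlt heq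
end
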